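/- For all parking functions a ∈ P_m and b ∈ P_n, Q_a ⋆ Q_b = Q_{a|b}. -/

import Mathlib

open scoped Classical

/-- Words on natural numbers (letters are intended to be positive integers). -/
abbrev W : Type := List ℕ

/-- `IsPF a` : the word `a` is a parking function, i.e. all its letters are
positive and its nondecreasing rearrangement `b₁ b₂ ⋯ bₙ` satisfies `bᵢ ≤ i`. -/
def IsPF (a : W) : Prop :=
  (∀ x ∈ a, 1 ≤ x) ∧
    ∀ i, i < a.length → (a.insertionSort (· ≤ ·)).getD i 0 ≤ i + 1

/-- Split a word into the consecutive segments beginning at its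
left-to-right minima (in the order in which they occur in the word). -/
def segs : W → List W
  | [] => []
  | x :: xs =>
      (x :: xs.takeWhile fun y => x ≤ y) :: segs (xs.dropWhile fun y => x ≤ y)
termination_by a => a.length
decreasing_by
  simpa using Nat.lt_succ_of_le (List.dropWhile_sublist _).length_le

/-- The LR-decomposition `F_a` of a word `a`: the sequence of segments beginning
at the left-to-right minima, listed in increasing order of their minimal letters
(i.e. in reverse order of occurrence in `a`). -/
def LR (a : W) : List W := (segs a).reverse

/-- The word `w_k ⋯ w_2 w_1` encoded by an LR-decomposition `(w_1, …, w_k)`. -/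
def wordOf (F : List W) : W := F.reverse.flatten

/-- A word is dominated if it is nonempty and its first letter is its minimal letter. -/
def Dominated (w : W) : Prop := w ≠ [] ∧ ∀ x ∈ w, w.headD 0 ≤ x

/-- The minimal letter of a word (`0` for the empty word). -/
def minW (w : W) : ℕ := (w.min?).getD 0

/-- Add `m` to every letter of a word. -/
def shiftW (m : ℕ) (w : W) : W := w.map (· + m)

/-- Add `m` to every letter of every word of a sequence of words. -/
def shiftF (m : ℕ) (F : List W) : List W := F.map (shiftW m)

/-- The word whose LR-decomposition is the finite set of words `G`:
sort `G` increasingly (for dominated words with distinct minimal letters the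
lexicographic order agrees with comparing the minimal letters) and concatenate
in decreasing order. -/
noncomputable def wordOfSet (G : Finset W) : W := (G.sort (· ≤ ·)).reverse.flatten

/-- Given vertex sets `X`, `Y` (of words) and a set `Θ` of edges, the resulting
set of words: concatenations `u ++ w` over edges `(u, w) ∈ Θ`, together with all
unmatched words of `X` and of `Y`. -/
noncomputable def glueSet (X Y : Finset W) (Θ : Finset (W × W)) : Finset W :=
  Θ.image (fun p => p.1 ++ p.2) ∪
    X.filter (fun u => ∀ p ∈ Θ, p.1 ≠ u) ∪
    Y.filter (fun w => ∀ p ∈ Θ, p.2 ≠ w)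

/-- `R(a,b)` : the set of matchings between `F_a` and `F_b + m` (`m` the length
of `a`), encoded as sets of edges in which no vertex occurs twice. -/
noncomputable def Rset (a b : W) : Finset (Finset (W × W)) :=
  ((LR a).toFinset ×ˢ (shiftF a.length (LR b)).toFinset).powerset.filter
    (fun Θ => ∀ p ∈ Θ, ∀ q ∈ Θ, (p.1 = q.1 ∨ p.2 = q.2) → p = q)

/-- `aΘb` : the parking function whose LR-decomposition consists of the
concatenations `u ⬝ (w + m)` over the edges `(u, w + m)` of `Θ` together with all
unmatched words of `F_a` and of `F_b + m`. -/
noncomputable def mTheta (a b : W) (Θ : Finset (W × W)) : W :=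
  wordOfSet (glueSet (LR a).toFinset (shiftF a.length (LR b)).toFinset Θ)

/-- `d(a) = min { i : #{ j : a_j ≤ i } < i }`. -/
def dVal (a : W) : ℕ :=
  Nat.find (p := fun i => (a.filter (fun x => x ≤ i)).length < i)
    ⟨a.length + 1, Nat.lt_succ_of_le (List.length_filter_le _ _)⟩

/-- One step of the parkization algorithm: decrement every letter greater
than `d(a)`.  (This is the identity when `a` is a parking function.) -/
def parkStep (a : W) : W := a.map fun x => if dVal a < x then x - 1 else x

/-- Auxiliary fueled version of the parkization algorithm. -/
def parkFuel : ℕ → W → W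
  | 0, a => a
  | k + 1, a => if dVal a = a.length + 1 then a else parkFuel k (parkStep a)

/-- The parkization `Park a` of a word `a`.  (For a word with positive letters
the algorithm needs at most `a.sum` steps, so the fuel below suffices.) -/
def Park (a : W) : W := parkFuel a.sum a

/-- The subword of `a` obtained by keeping exactly the words of `F_a`
belonging to `S`. -/
def subWord (a : W) (S : Finset W) : W := wordOf ((LR a).filter (· ∈ S))

/-- The free module with basis indexed by words; the Hopf algebra `PFSym` is
its submodule spanned by `{M_a : a ∈ P}`. -/
abbrev FW (K : Type) [Field K] : Type := W →₀ K

/-- The monomial basis element `M_a`. -/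
noncomputable def Mb (K : Type) [Field K] (a : W) : FW K := Finsupp.single a 1

/-- `M_a ⋆ M_b = Σ_{Θ ∈ R(a,b)} M_{aΘb}` on basis elements. -/
noncomputable def mulSingle (K : Type) [Field K] (a b : W) : FW K :=
  ∑ Θ ∈ Rset a b, Mb K (mTheta a b Θ)

/-- The product `⋆`, extended bilinearly. -/
noncomputable def starF (K : Type) [Field K] (x y : FW K) : FW K :=
  x.sum fun a ca => y.sum fun b cb => (ca * cb) • mulSingle K a b

/-- The free module with basis indexed by pairs of words; it realizes the
tensor square of `FW K` via `M_a ⊗ M_b ↦ single (a,b)`. -/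
abbrev FW2 (K : Type) [Field K] : Type := (W × W) →₀ K

/-- `Δ(M_a) = Σ M_{Park a'} ⊗ M_{Park a''}` over ordered pairs `(a', a'')` of
subwords of `a` with `F_{a'} ⊍ F_{a''} = F_a` (encoded by the subset
`S ⊆ F_a` of words kept in `a'`). -/
noncomputable def deltaSingle (K : Type) [Field K] (a : W) : FW2 K :=
  ∑ S ∈ ((LR a).toFinset).powerset,
    Finsupp.single
      (Park (subWord a S), Park (subWord a (((LR a).toFinset) \ S))) 1

/-- The coproduct `Δ`, extended linearly. -/
noncomputable def deltaF (K : Type) [Field K] (x : FW K) : FW2 K :=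
  x.sum fun a ca => ca • deltaSingle K a

/-- The componentwise product on the tensor square, on basis elements:
`(M_a ⊗ M_b) ⋆ (M_c ⊗ M_d) = (M_a ⋆ M_c) ⊗ (M_b ⋆ M_d)`. -/
noncomputable def star2Single (K : Type) [Field K] (p q : W × W) : FW2 K :=
  ∑ Θ ∈ Rset p.1 q.1, ∑ Θ' ∈ Rset p.2 q.2,
    Finsupp.single (mTheta p.1 q.1 Θ, mTheta p.2 q.2 Θ') 1

/-- The componentwise product on the tensor square, extended bilinearly. -/
noncomputable def star2F (K : Type) [Field K] (x y : FW2 K) : FW2 K :=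
  x.sum fun p cp => y.sum fun q cq => (cp * cq) • star2Single K p q

/-- The counit `ε` on basis elements. -/
noncomputable def epsW (K : Type) [Field K] (a : W) : K := if a = [] then 1 else 0

/-- `F_a ∘ F_b` : concatenate the `i`-th words of `F_a` and `F_b + m`
for `i ≤ min(r,s)` and keep the remaining unpaired words. -/
def splitLR (F G : List W) : List W :=
  List.zipWith (· ++ ·) F G ++ F.drop G.length ++ G.drop F.length

/-- The split product `a ∘ b`. -/
def splitProd (a b : W) : W := wordOf (splitLR (LR a) (shiftF a.length (LR b)))

/-- A nonempty parking function is unsplitable if it is not the split product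
of two nonempty parking functions. -/
def UnsplitablePF (a : W) : Prop :=
  IsPF a ∧ a ≠ [] ∧
    ¬ ∃ b c : W, IsPF b ∧ IsPF c ∧ b ≠ [] ∧ c ≠ [] ∧ a = splitProd b c

/-- The slash product `a | b = (b₁+m) ⋯ (bₙ+m) a₁ ⋯ a_m`. -/
def slashProd (a b : W) : W := shiftW a.length b ++ a

/-- A nonempty parking function is atomic if it is not the slash product
of two nonempty parking functions. -/
def AtomicPF (a : W) : Prop :=
  IsPF a ∧ a ≠ [] ∧
    ¬ ∃ b c : W, IsPF b ∧ IsPF c ∧ b ≠ [] ∧ c ≠ [] ∧ a = slashProd b c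

/-- `u ≺* v` : either `v` is a proper initial subword of `u`, or `u` is not a
proper initial subword of `v` and `u` precedes `v` lexicographically. -/
def precStar (u v : W) : Prop :=
  (v <+: u ∧ v ≠ u) ∨ (¬ (u <+: v ∧ u ≠ v) ∧ List.Lex (· < ·) u v)

/-- `a ≺*_lex b` : `F_a` strictly precedes `F_b` in the lexicographic order
on sequences of words induced by `≺*`. -/
def precStarLex (a b : W) : Prop := List.Lex precStar (LR a) (LR b)

/-- The covering relation of `≤_*` : `b` covers `a` if `F_b` is obtained from
`F_a = (w_1, …, w_r)` by replacing `w_i` by `w_i ⬝ w_j` and removing `w_j`,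
for some `i < j` such that every letter of `w_i` is at most every letter of `w_j`. -/
def CovStar (a b : W) : Prop :=
  ∃ i j, i < j ∧ j < (LR a).length ∧
    (∀ x ∈ (LR a).getD i [], ∀ y ∈ (LR a).getD j [], x ≤ y) ∧
    LR b = ((LR a).set i ((LR a).getD i [] ++ (LR a).getD j [])).eraseIdx j

/-- The partial order `≤_*` on parking functions, generated by the covering
relations. -/
def leStar (a b : W) : Prop := Relation.ReflTransGen CovStar a b

/-- The finite set of all parking functions of length `n`. -/
noncomputable def pfFinset (n : ℕ) : Finset W :=
  ((Finset.univ : Finset (Fin n → Fin n)).image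
      (fun f => List.ofFn fun i => (f i).val + 1)).filter IsPF

/-- The basis element `Q_a = Σ_{a ≤_* b} M_b`. -/
noncomputable def Qb (K : Type) [Field K] (a : W) : FW K :=
  ∑ b ∈ (pfFinset a.length).filter (fun b => leStar a b), Mb K b

/-- `Q_x ⊗ Q_y` as an element of the tensor square. -/
noncomputable def QT (K : Type) [Field K] (x y : W) : FW2 K :=
  ∑ b ∈ (pfFinset x.length).filter (fun b => leStar x b),
    ∑ c ∈ (pfFinset y.length).filter (fun c => leStar y c),
      Finsupp.single (b, c) 1

/-- `a` is a nonincreasing word. -/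
def NonInc (a : W) : Prop := a.Chain' (fun x y => y ≤ x)

/-- Every word of the LR-decomposition of `a` is nondecreasing. -/
def Nprop (a : W) : Prop := ∀ w ∈ LR a, w.Chain' (· ≤ ·)

/-- The words of the LR-decomposition of `a` have pairwise disjoint sets of letters. -/
def Dprop (a : W) : Prop := (LR a).Pairwise (fun u v => ∀ x ∈ u, x ∉ v)

/-- `a` is a permutation of `{1, …, n}` viewed as a word. -/
def Sprop (a : W) : Prop := a.Perm (List.range' 1 a.length)


def Desc (L : List W) : Prop :=
  (∀ w ∈ L, Dominated w) ∧ L.Pairwise (fun u v => v.headD 0 < u.headD 0)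

theorem segs_nil : segs [] = [] := by rw [segs]
theorem segs_cons (x : ℕ) (xs : W) : segs (x :: xs) =
  (x :: xs.takeWhile fun y => x ≤ y) :: segs (xs.dropWhile fun y => x ≤ y) := by rw [segs]

theorem segs_spec (n : ℕ) : ∀ a : W, a.length ≤ n →
    Desc (segs a) ∧ (segs a).flatten = a ∧ ∀ w ∈ segs a, w.headD 0 ≤ a.headD 0 := by
  induction n with
  | zero =>
    intro a ha
    have : a = [] := by simpa using ha
    subst this
    simp [segs_nil, Desc]
  | succ n ih =>
    intro a ha
    cases a with
    | nil => simp [segs_nil, Desc]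
    | cons x xs =>
      rw [segs_cons]
      have hl := (List.dropWhile_sublist (l := xs) (fun y => decide (x ≤ y))).length_le
      have hd : ∀ z zs, xs.dropWhile (fun y => decide (x ≤ y)) = z :: zs → z < x := by
        intro z zs hz
        have h := List.head_dropWhile_not (fun y => decide (x ≤ y)) (l := xs) (by simp [hz])
        simp only [hz, List.head_cons] at h
        simpa using h
      generalize hD : xs.dropWhile (fun y => decide (x ≤ y)) = D at *
      simp only [List.length_cons] at ha
      obtain ⟨⟨h1, h2⟩, h3, h4⟩ := ih D (by omega)
      have hlt : ∀ w ∈ segs D, w.headD 0 < x := by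
        intro w hw
        cases D with
        | nil => simp [segs_nil] at hw
        | cons z zs =>
          have := h4 w hw
          have := hd z zs rfl
          simp at *
          omega
      refine ⟨⟨?_, ?_⟩, ?_, ?_⟩
      · intro w hw
        rcases List.mem_cons.1 hw with rfl | hw
        · refine ⟨by simp, ?_⟩
          intro y hy
          rcases List.mem_cons.1 hy with rfl | hy
          · simp
          · have := List.mem_takeWhile_imp hy
            simpa using this
        · exact h1 w hw
      · exact List.pairwise_cons.2 ⟨fun w hw => by simpa using hlt w hw, h2⟩
      · simp only [List.flatten_cons, h3]
        rw [← hD]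
        simp
      · intro w hw
        rcases List.mem_cons.1 hw with rfl | hw
        · simp
        · have := hlt w hw
          simp at *
          omega

theorem segs_desc (a : W) : Desc (segs a) := (segs_spec _ a le_rfl).1
theorem segs_flat (a : W) : (segs a).flatten = a := (segs_spec _ a le_rfl).2.1

theorem segs_flatten (L : List W) (h : Desc L) : segs L.flatten = L := by
  induction L with
  | nil => simp [segs_nil]
  | cons w L ih =>
    obtain ⟨h1, h2⟩ := h
    have hL : Desc L := ⟨fun v hv => h1 v (by simp [hv]), (List.pairwise_cons.1 h2).2⟩
    have ih := ih hL
    have hw := h1 w (by simp)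
    cases w with
    | nil => exact absurd rfl hw.1
    | cons x xs =>
      have hx : ∀ y ∈ xs, decide (x ≤ y) = true := by
        intro y hy
        have := hw.2 y (by simp [hy])
        simpa using this
      have hlt : ∀ y, L.flatten.head? = some y → y < x := by
        cases L with
        | nil => simp
        | cons v L =>
          have hv := h1 v (by simp)
          have := (List.pairwise_cons.1 h2).1 v (by simp)
          cases v with
          | nil => exact absurd rfl hv.1
          | cons z zs => simpa using this
      have e1 : L.flatten.takeWhile (fun y => decide (x ≤ y)) = [] := by
        cases hF : L.flatten with
        | nil => simp
        | cons y ys =>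
          have := hlt y (by simp [hF])
          simp [this]
      have e2 : L.flatten.dropWhile (fun y => decide (x ≤ y)) = L.flatten := by
        cases hF : L.flatten with
        | nil => simp
        | cons y ys =>
          have := hlt y (by simp [hF])
          simp [this]
      rw [List.flatten_cons, List.cons_append, segs_cons, List.takeWhile_append_of_pos hx,
        List.dropWhile_append_of_pos hx, e1, e2, ih]
      simp

/-- The set of words of the LR-decomposition. -/
def FS (a : W) : Finset W := (LR a).toFinset

def Good (G : Finset W) : Prop :=
  (∀ w ∈ G, Dominated w) ∧ ∀ w ∈ G, ∀ w' ∈ G, w.headD 0 = w'.headD 0 → w = w'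

theorem lt_of_head {u v : W} (hu : u ≠ []) (hv : v ≠ []) (h : u.headD 0 < v.headD 0) : u < v := by
  cases u with
  | nil => simp at hu
  | cons x xs =>
    cases v with
    | nil => simp at hv
    | cons y ys =>
      exact List.cons_lt_cons_iff.2 (Or.inl (by simpa using h))

theorem head_le_of_le {u v : W} (hu : u ≠ []) (hv : v ≠ []) (h : u ≤ v) :
    u.headD 0 ≤ v.headD 0 := by
  by_contra hc
  exact absurd (lt_of_head hv hu (not_le.1 hc)) (not_lt.2 h)

theorem Desc.good {L : List W} (h : Desc L) : Good L.toFinset := by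
  refine ⟨fun w hw => h.1 w (by simpa using hw), ?_⟩
  intro w hw w' hw' e
  by_contra hne
  simp only [List.mem_toFinset] at hw hw'
  have key := h.2.imp (S := fun u v => u.headD 0 ≠ v.headD 0) (fun h => by omega)
  have : Std.Symm (fun u v : W => u.headD 0 ≠ v.headD 0) := ⟨fun _ _ h => h.symm⟩
  exact key.forall hw hw' hne e

theorem FS_good (a : W) : Good (FS a) := by
  have := (segs_desc a).good
  simpa [FS, LR] using this

theorem Desc.nodup {L : List W} (h : Desc L) : L.Nodup :=
  h.2.imp (fun h e => by subst e; omega)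

theorem Desc.sort_eq {L : List W} (h : Desc L) :
    L.toFinset.sort (· ≤ ·) = L.reverse := by
  rw [← List.toFinset_reverse, List.toFinset_sort (· ≤ ·) (List.nodup_reverse.2 h.nodup)]
  rw [List.pairwise_reverse]
  refine List.Pairwise.imp_of_mem ?_ h.2
  intro u v hu hv huv
  exact (lt_of_head (h.1 v hv).1 (h.1 u hu).1 huv).le

theorem wordOfSet_FS (a : W) : wordOfSet (FS a) = a := by
  unfold wordOfSet FS LR
  rw [List.toFinset_reverse, (segs_desc a).sort_eq, List.reverse_reverse, segs_flat]

theorem Good.desc {G : Finset W} (h : Good G) : Desc (G.sort (· ≤ ·)).reverse := by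
  refine ⟨fun w hw => h.1 w (by simpa using hw), ?_⟩
  rw [List.pairwise_reverse]
  have := (G.pairwise_sort (· ≤ ·)).and (G.sort_nodup (· ≤ ·))
  refine List.Pairwise.imp_of_mem ?_ this
  rintro u v hu hv ⟨h1, h2⟩
  simp only [Finset.mem_sort] at hu hv
  exact lt_of_le_of_ne (head_le_of_le (h.1 u hu).1 (h.1 v hv).1 h1)
    (fun e => h2 (h.2 u hu v hv e))

theorem FS_wordOfSet {G : Finset W} (h : Good G) : FS (wordOfSet G) = G := by
  unfold wordOfSet FS LR
  rw [segs_flatten _ h.desc]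
  simp

theorem LR_eq {a : W} {L : List W} (h : Desc L.reverse) (e : FS a = L.toFinset) : LR a = L := by
  have h1 := (segs_desc a).sort_eq
  have h2 := h.sort_eq
  simp only [List.toFinset_reverse, List.reverse_reverse] at h2
  rw [← h2, ← e, FS, LR, List.toFinset_reverse, h1]

def Step (G G' : Finset W) : Prop :=
  ∃ u ∈ G, ∃ v ∈ G, u ≠ v ∧ (∀ x ∈ u, ∀ y ∈ v, x ≤ y) ∧
    G' = insert (u ++ v) ((G.erase u).erase v)

theorem covStar_iff (a b : W) : CovStar a b ↔ ∃ A B C u v, LR a = A ++ u :: (B ++ v :: C) ∧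
    (∀ x ∈ u, ∀ y ∈ v, x ≤ y) ∧ LR b = A ++ (u ++ v) :: (B ++ C) := by
  constructor
  · rintro ⟨i, j, hij, hj, hle, hb⟩
    obtain ⟨A, B, C, u, v, e, hA, hB⟩ : ∃ A B C u v, LR a = A ++ u :: (B ++ v :: C) ∧
        A.length = i ∧ B.length = j - i - 1 := by
      refine ⟨(LR a).take i, ((LR a).drop (i+1)).take (j-i-1), (LR a).drop (j+1),
        (LR a)[i], (LR a)[j], ?_, by simp; omega, by simp; omega⟩
      conv_lhs => rw [← List.take_append_drop i (LR a), List.drop_eq_getElem_cons (by omega)]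
      congr 2
      conv_lhs => rw [← List.take_append_drop (j-i-1) ((LR a).drop (i+1))]
      congr 1
      rw [List.drop_drop, List.drop_eq_getElem_cons (by omega)]
      have : i + 1 + (j - i - 1) = j := by omega
      simp [this]
    obtain rfl : j = A.length + (B.length + 1) := by omega
    subst hA
    rw [e] at hle hb
    simp [List.getElem?_append_right, List.eraseIdx_append_of_length_le] at hle hb
    exact ⟨A, B, C, u, v, e, hle, hb⟩
  · rintro ⟨A, B, C, u, v, e, hle, hb⟩
    refine ⟨A.length, A.length + (B.length + 1), by omega, by simp [e], ?_, ?_⟩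
    · rw [e]
      simpa [List.getElem?_append_right] using hle
    · rw [e, hb]
      simp [List.getElem?_append_right, List.eraseIdx_append_of_length_le]

theorem step_of_cov {a b : W} (h : CovStar a b) : Step (FS a) (FS b) := by
  obtain ⟨A, B, C, u, v, e, hle, hb⟩ := (covStar_iff a b).1 h
  have hn : (LR a).Nodup := by
    unfold LR
    exact List.nodup_reverse.2 (segs_desc a).nodup
  unfold FS
  rw [e] at hn ⊢
  rw [hb]
  refine ⟨u, by simp, v, by simp, ?_, hle, ?_⟩
  · rintro rfl
    simp [List.nodup_append] at hn
  · ext w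
    simp [List.nodup_append, List.nodup_cons] at hn ⊢
    grind

theorem cov_of_step {a : W} {G : Finset W} (h : Step (FS a) G) :
    Good G ∧ CovStar a (wordOfSet G) := by
  obtain ⟨u, hu, v, hv, huv, hle, rfl⟩ := h
  have hg := FS_good a
  have hGood : Good (insert (u ++ v) (((FS a).erase u).erase v)) := by
    obtain ⟨hu0, hu1⟩ := hg.1 u hu
    obtain ⟨hv0, hv1⟩ := hg.1 v hv
    cases u with
    | nil => simp at hu0
    | cons x xs =>
    have hh : ((x :: xs) ++ v).headD 0 = x := by simp
    constructor
    · intro w hw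
      rcases Finset.mem_insert.1 hw with rfl | hw
      · refine ⟨by simp, ?_⟩
        intro y hy
        rcases List.mem_append.1 hy with hy | hy
        · exact hu1 y hy
        · exact hle x (by simp) y hy
      · exact hg.1 w (Finset.mem_of_mem_erase (Finset.mem_of_mem_erase hw))
    · intro w hw w' hw' e
      have key := hg.2 _ hu
      rcases Finset.mem_insert.1 hw with rfl | hw <;> rcases Finset.mem_insert.1 hw' with rfl | hw'
      · rfl
      · simp only [Finset.mem_erase] at hw'
        exact absurd (key w' hw'.2.2 (by simpa using e)).symm hw'.2.1
      · simp only [Finset.mem_erase] at hw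
        exact absurd (key w hw.2.2 (by simpa using e.symm)).symm hw.2.1
      · simp only [Finset.mem_erase] at hw hw'
        exact hg.2 w hw.2.2 w' hw'.2.2 e
  refine ⟨hGood, ?_⟩
  rw [covStar_iff]
  have hasc : (LR a).Pairwise (fun u v => u.headD 0 < v.headD 0) := by
    unfold LR
    exact List.pairwise_reverse.2 (segs_desc a).2
  have hn : (LR a).Nodup := by
    unfold LR
    exact List.nodup_reverse.2 (segs_desc a).nodup
  have hu' : u ∈ LR a := by simpa [FS] using hu
  have hv' : v ∈ LR a := by simpa [FS] using hv
  have hud := hg.1 u hu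
  have hvd := hg.1 v hv
  have hhle : u.headD 0 ≤ v.headD 0 := by
    cases u with
    | nil => simp [Dominated] at hud
    | cons x xs =>
      cases v with
      | nil => simp [Dominated] at hvd
      | cons y ys => exact hle x (by simp) y (by simp)
  have hhu : (u ++ v).headD 0 = u.headD 0 := by
    cases u with
    | nil => simp [Dominated] at hud
    | cons x xs => simp
  obtain ⟨A, R, e⟩ := List.append_of_mem hu'
  have hvR : v ∈ R := by
    rw [e] at hv' hasc
    rcases List.mem_append.1 hv' with h | h
    · have := (List.pairwise_append.1 hasc).2.2 v h u (by simp)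
      omega
    · rcases List.mem_cons.1 h with h | h
      · exact absurd h.symm huv
      · exact h
  obtain ⟨B, C, rfl⟩ := List.append_of_mem hvR
  refine ⟨A, B, C, u, v, e, hle, ?_⟩
  have hset : FS (wordOfSet (insert (u ++ v) (((FS a).erase u).erase v))) =
      (A ++ (u ++ v) :: (B ++ C)).toFinset := by
    rw [FS_wordOfSet hGood]
    unfold FS
    rw [e] at hn ⊢
    ext w
    simp [List.nodup_append, List.nodup_cons] at hn ⊢
    grind
  apply LR_eq _ hset
  rw [FS_wordOfSet hGood] at hset
  refine ⟨?_, ?_⟩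
  · intro w hw
    apply hGood.1
    rw [hset]
    simp at hw ⊢
    tauto
  · rw [List.pairwise_reverse]
    rw [e] at hasc
    simp only [List.pairwise_append, List.pairwise_cons, List.mem_append, List.mem_cons] at hasc ⊢
    rw [hhu]
    grind

theorem rtg_of_le {a b : W} (h : leStar a b) : Relation.ReflTransGen Step (FS a) (FS b) :=
  by
  induction h with
  | refl => exact Relation.ReflTransGen.refl
  | tail _ hs ih => exact ih.tail (step_of_cov hs)

theorem le_of_rtg {a : W} {G : Finset W} (h : Relation.ReflTransGen Step (FS a) G) :
    Good G ∧ leStar a (wordOfSet G) := by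
  induction h with
  | refl => exact ⟨FS_good a, by rw [wordOfSet_FS]; exact Relation.ReflTransGen.refl⟩
  | tail _ hs ih =>
    obtain ⟨hg, hl⟩ := ih
    rw [← FS_wordOfSet hg] at hs
    obtain ⟨h1, h2⟩ := cov_of_step hs
    exact ⟨h1, hl.tail h2⟩


def Pr (p : ℕ → Bool) (G : Finset W) : Finset W := (G.image (List.filter p)).erase []

def Inj (p : ℕ → Bool) (G : Finset W) : Prop :=
  ∀ w ∈ G, ∀ w' ∈ G, w.filter p ≠ [] → w'.filter p ≠ [] →
    (w.filter p).headD 0 = (w'.filter p).headD 0 → w = w'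

theorem headD_append' (u v : W) : (u ++ v).headD 0 = if u = [] then v.headD 0 else u.headD 0 := by
  cases u <;> simp

theorem mem_Pr {p : ℕ → Bool} {G : Finset W} {z : W} :
    z ∈ Pr p G ↔ z ≠ [] ∧ ∃ w ∈ G, w.filter p = z := by
  simp [Pr]

theorem inj_step {p : ℕ → Bool} {G G' : Finset W} (hi : Inj p G) (h : Step G G') : Inj p G' := by
  obtain ⟨u, hu, v, hv, huv, hle, rfl⟩ := h
  have key : ∀ w ∈ G, w ≠ u → w ≠ v → w.filter p ≠ [] → (u ++ v).filter p ≠ [] →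
      (w.filter p).headD 0 = ((u ++ v).filter p).headD 0 → False := by
    intro w hw h1 h2 h3 h4 h5
    rw [List.filter_append, headD_append'] at h5
    split_ifs at h5 with h
    · exact h2 (hi w hw v hv h3 (by simpa [h] using h4) h5)
    · exact h1 (hi w hw u hu h3 h h5)
  intro w hw w' hw' h1 h2 h3
  simp only [Finset.mem_insert, Finset.mem_erase] at hw hw'
  rcases hw with rfl | hw <;> rcases hw' with rfl | hw'
  · rfl
  · exact (key w' hw'.2.2 hw'.2.1 hw'.1 h2 h1 h3.symm).elim
  · exact (key w hw.2.2 hw.2.1 hw.1 h1 h2 h3).elim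
  · exact hi w hw.2.2 w' hw'.2.2 h1 h2 h3

theorem pr_step {p : ℕ → Bool} {G G' : Finset W} (hi : Inj p G) (h : Step G G') :
    Relation.ReflTransGen Step (Pr p G) (Pr p G') := by
  obtain ⟨u, hu, v, hv, huv, hle, rfl⟩ := h
  have inj : ∀ w ∈ G, ∀ w' ∈ G, w.filter p ≠ [] → w.filter p = w'.filter p → w = w' := by
    intro w hw w' hw' h e
    exact hi w hw w' hw' h (e ▸ h) (by rw [e])
  by_cases h1 : u.filter p = []
  · have : Pr p (insert (u ++ v) ((G.erase u).erase v)) = Pr p G := by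
      ext z
      simp only [mem_Pr, Finset.mem_insert, Finset.mem_erase]
      constructor
      · rintro ⟨hz, w, rfl | hw, e⟩
        · exact ⟨hz, v, hv, by simpa [h1] using e⟩
        · exact ⟨hz, w, hw.2.2, e⟩
      · rintro ⟨hz, w, hw, e⟩
        refine ⟨hz, ?_⟩
        by_cases hwv : w = v
        · exact ⟨u ++ v, Or.inl rfl, by rw [List.filter_append, h1, ← hwv, e]; rfl⟩
        · refine ⟨w, Or.inr ⟨hwv, ?_, hw⟩, e⟩
          rintro rfl
          exact hz (e ▸ h1)
    rw [this]
  · by_cases h2 : v.filter p = []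
    · have : Pr p (insert (u ++ v) ((G.erase u).erase v)) = Pr p G := by
        ext z
        simp only [mem_Pr, Finset.mem_insert, Finset.mem_erase]
        constructor
        · rintro ⟨hz, w, rfl | hw, e⟩
          · exact ⟨hz, u, hu, by simpa [h2] using e⟩
          · exact ⟨hz, w, hw.2.2, e⟩
        · rintro ⟨hz, w, hw, e⟩
          refine ⟨hz, ?_⟩
          by_cases hwv : w = u
          · exact ⟨u ++ v, Or.inl rfl, by rw [List.filter_append, h2, ← hwv, e]; simp⟩
          · refine ⟨w, Or.inr ⟨?_, hwv, hw⟩, e⟩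
            rintro rfl
            exact hz (e ▸ h2)
      rw [this]
    · apply Relation.ReflTransGen.single
      refine ⟨u.filter p, mem_Pr.2 ⟨h1, u, hu, rfl⟩, v.filter p, mem_Pr.2 ⟨h2, v, hv, rfl⟩,
        fun e => huv (inj u hu v hv h1 e), ?_, ?_⟩
      · intro x hx y hy
        exact hle x (List.mem_filter.1 hx).1 y (List.mem_filter.1 hy).1
      · ext z
        simp only [mem_Pr, Finset.mem_insert, Finset.mem_erase]
        constructor
        · rintro ⟨hz, w, rfl | hw, e⟩
          · left; rw [← e]; simp
          · right
            subst e
            exact ⟨fun e => hw.1 (inj w hw.2.2 v hv hz e), fun e => hw.2.1 (inj w hw.2.2 u hu hz e),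
              hz, w, hw.2.2, rfl⟩
        · rintro (rfl | ⟨ha, hb, hz, w, hw, rfl⟩)
          · exact ⟨by simp [h1], u ++ v, Or.inl rfl, by simp⟩
          · refine ⟨hz, w, Or.inr ⟨?_, ?_, hw⟩, rfl⟩
            · rintro rfl; exact ha rfl
            · rintro rfl; exact hb rfl

def lo (m : ℕ) : ℕ → Bool := fun x => decide (x ≤ m)
def hi (m : ℕ) : ℕ → Bool := fun x => decide (m < x)

def Spl (m : ℕ) (G : Finset W) : Prop := ∀ w ∈ G, w.filter (lo m) ++ w.filter (hi m) = w

theorem spl_step {m : ℕ} {G G' : Finset W} (hs : Spl m G) (h : Step G G') : Spl m G' := by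
  obtain ⟨u, hu, v, hv, huv, hle, rfl⟩ := h
  intro w hw
  simp only [Finset.mem_insert, Finset.mem_erase] at hw
  rcases hw with rfl | hw
  · have eu := hs u hu
    have ev := hs v hv
    have : u.filter (hi m) = [] ∨ v.filter (lo m) = [] := by
      by_contra hc
      push Not at hc
      obtain ⟨x, hx⟩ := List.exists_mem_of_ne_nil _ hc.1
      obtain ⟨y, hy⟩ := List.exists_mem_of_ne_nil _ hc.2
      simp only [List.mem_filter, lo, hi, decide_eq_true_eq] at hx hy
      have := hle x hx.1 y hy.1
      omega
    rw [List.filter_append, List.filter_append]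
    conv_rhs => rw [← eu, ← ev]
    rcases this with h | h <;> simp [h]
  · exact hs w hw.2.2

theorem nil_step {G G' : Finset W} (hs : [] ∉ G) (h : Step G G') : [] ∉ G' := by
  obtain ⟨u, hu, v, hv, huv, hle, rfl⟩ := h
  simp only [Finset.mem_insert, Finset.mem_erase]
  rintro (h | h)
  · have := List.append_eq_nil_iff.1 h.symm
    exact hs (this.1 ▸ hu)
  · exact hs h.2.2

def Th (m : ℕ) (G : Finset W) : Finset (W × W) :=
  (G.image (fun w => (w.filter (lo m), w.filter (hi m)))).filter (fun p => p.1 ≠ [] ∧ p.2 ≠ [])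

theorem mem_Th {m : ℕ} {G : Finset W} {p : W × W} :
    p ∈ Th m G ↔ p.1 ≠ [] ∧ p.2 ≠ [] ∧ ∃ w ∈ G, w.filter (lo m) = p.1 ∧ w.filter (hi m) = p.2 := by
  rcases p with ⟨p1, p2⟩
  simp only [Th, Finset.mem_filter, Finset.mem_image, Prod.mk.injEq]
  tauto

theorem mem_glue {X Y : Finset W} {Θ : Finset (W × W)} {w : W} :
    w ∈ glueSet X Y Θ ↔ (∃ p ∈ Θ, p.1 ++ p.2 = w) ∨ (w ∈ X ∧ ∀ p ∈ Θ, p.1 ≠ w) ∨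
      (w ∈ Y ∧ ∀ p ∈ Θ, p.2 ≠ w) := by
  simp only [glueSet, Finset.mem_union, Finset.mem_image, Finset.mem_filter, or_assoc]

def Mat (X Y : Finset W) (Θ : Finset (W × W)) : Prop :=
  Θ ⊆ X ×ˢ Y ∧ ∀ p ∈ Θ, ∀ q ∈ Θ, (p.1 = q.1 ∨ p.2 = q.2) → p = q

/-- Words of `X` are nonempty with letters at most `m`, words of `Y` are nonempty with letters
larger than `m`. -/
def SepW (m : ℕ) (X Y : Finset W) : Prop :=
  (∀ u ∈ X, u ≠ [] ∧ ∀ x ∈ u, x ≤ m) ∧ (∀ u ∈ Y, u ≠ [] ∧ ∀ x ∈ u, m < x)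

section
variable {m : ℕ} {X Y : Finset W} {Θ : Finset (W × W)}

theorem SepW.lo_X (h : SepW m X Y) {u : W} (hu : u ∈ X) : u.filter (lo m) = u :=
  List.filter_eq_self.2 (fun x hx => by simpa [lo] using (h.1 u hu).2 x hx)
theorem SepW.hi_X (h : SepW m X Y) {u : W} (hu : u ∈ X) : u.filter (hi m) = [] :=
  List.filter_eq_nil_iff.2 (fun x hx => by simpa [hi] using (h.1 u hu).2 x hx)
theorem SepW.lo_Y (h : SepW m X Y) {u : W} (hu : u ∈ Y) : u.filter (lo m) = [] :=
  List.filter_eq_nil_iff.2 (fun x hx => by simpa [lo] using (h.2 u hu).2 x hx)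
theorem SepW.hi_Y (h : SepW m X Y) {u : W} (hu : u ∈ Y) : u.filter (hi m) = u :=
  List.filter_eq_self.2 (fun x hx => by simpa [hi] using (h.2 u hu).2 x hx)

theorem Pr_lo_glue (h : SepW m X Y) (hm : Mat X Y Θ) : Pr (lo m) (glueSet X Y Θ) = X := by
  ext z
  simp only [mem_Pr, mem_glue]
  constructor
  · rintro ⟨hz, w, ⟨p, hp, rfl⟩ | ⟨hw, _⟩ | ⟨hw, _⟩, rfl⟩
    · have := Finset.mem_product.1 (hm.1 hp)
      rw [List.filter_append, h.lo_X this.1, h.lo_Y this.2, List.append_nil]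
      exact this.1
    · rwa [h.lo_X hw]
    · exact absurd (h.lo_Y hw) hz
  · intro hz
    refine ⟨(h.1 z hz).1, ?_⟩
    by_cases hc : ∃ p ∈ Θ, p.1 = z
    · obtain ⟨p, hp, rfl⟩ := hc
      have := Finset.mem_product.1 (hm.1 hp)
      exact ⟨p.1 ++ p.2, Or.inl ⟨p, hp, rfl⟩, by
        rw [List.filter_append, h.lo_X this.1, h.lo_Y this.2, List.append_nil]⟩
    · push Not at hc
      exact ⟨z, Or.inr (Or.inl ⟨hz, hc⟩), h.lo_X hz⟩

theorem Pr_hi_glue (h : SepW m X Y) (hm : Mat X Y Θ) : Pr (hi m) (glueSet X Y Θ) = Y := by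
  ext z
  simp only [mem_Pr, mem_glue]
  constructor
  · rintro ⟨hz, w, ⟨p, hp, rfl⟩ | ⟨hw, _⟩ | ⟨hw, _⟩, rfl⟩
    · have := Finset.mem_product.1 (hm.1 hp)
      rw [List.filter_append, h.hi_X this.1, h.hi_Y this.2, List.nil_append]
      exact this.2
    · exact absurd (h.hi_X hw) hz
    · rwa [h.hi_Y hw]
  · intro hz
    refine ⟨(h.2 z hz).1, ?_⟩
    by_cases hc : ∃ p ∈ Θ, p.2 = z
    · obtain ⟨p, hp, rfl⟩ := hc
      have := Finset.mem_product.1 (hm.1 hp)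
      exact ⟨p.1 ++ p.2, Or.inl ⟨p, hp, rfl⟩, by
        rw [List.filter_append, h.hi_X this.1, h.hi_Y this.2, List.nil_append]⟩
    · push Not at hc
      exact ⟨z, Or.inr (Or.inr ⟨hz, hc⟩), h.hi_Y hz⟩

theorem Th_glue (h : SepW m X Y) (hm : Mat X Y Θ) : Th m (glueSet X Y Θ) = Θ := by
  have main : ∀ p ∈ Θ, (p.1 ++ p.2).filter (lo m) = p.1 ∧ (p.1 ++ p.2).filter (hi m) = p.2 := by
    intro p hp
    have := Finset.mem_product.1 (hm.1 hp)
    rw [List.filter_append, List.filter_append, h.lo_X this.1, h.lo_Y this.2, h.hi_X this.1,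
      h.hi_Y this.2]
    simp
  ext z
  simp only [mem_Th, mem_glue]
  constructor
  · rintro ⟨h1, h2, w, ⟨p, hp, rfl⟩ | ⟨hw, _⟩ | ⟨hw, _⟩, e1, e2⟩
    · rw [(main p hp).1] at e1
      rw [(main p hp).2] at e2
      have : p = z := Prod.ext e1 e2
      exact this ▸ hp
    · exact absurd (e2 ▸ h.hi_X hw) h2
    · exact absurd (e1 ▸ h.lo_Y hw) h1
  · intro hz
    have := Finset.mem_product.1 (hm.1 hz)
    exact ⟨(h.1 _ this.1).1, (h.2 _ this.2).1, _, Or.inl ⟨z, hz, rfl⟩, main z hz⟩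

theorem mat_Th {G : Finset W} (hlo : Inj (lo m) G) (hhi : Inj (hi m) G) :
    Mat (Pr (lo m) G) (Pr (hi m) G) (Th m G) := by
  constructor
  · intro p hp
    obtain ⟨h1, h2, w, hw, e1, e2⟩ := mem_Th.1 hp
    exact Finset.mem_product.2 ⟨mem_Pr.2 ⟨h1, w, hw, e1⟩, mem_Pr.2 ⟨h2, w, hw, e2⟩⟩
  · intro p hp q hq hpq
    obtain ⟨h1, h2, w, hw, e1, e2⟩ := mem_Th.1 hp
    obtain ⟨h1', h2', w', hw', e1', e2'⟩ := mem_Th.1 hq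
    have : w = w' := by
      rcases hpq with h | h
      · exact hlo w hw w' hw' (e1 ▸ h1) (e1' ▸ h1') (by rw [e1, e1', h])
      · exact hhi w hw w' hw' (e2 ▸ h2) (e2' ▸ h2') (by rw [e2, e2', h])
    subst this
    exact Prod.ext (e1 ▸ e1') (e2 ▸ e2')

theorem glue_Th {G : Finset W} (hlo : Inj (lo m) G) (hhi : Inj (hi m) G) (hs : Spl m G)
    (h0 : [] ∉ G) : glueSet (Pr (lo m) G) (Pr (hi m) G) (Th m G) = G := by
  ext z
  rw [mem_glue]
  constructor
  · rintro (⟨p, hp, rfl⟩ | ⟨hz, hu⟩ | ⟨hz, hu⟩)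
    · obtain ⟨h1, h2, w, hw, e1, e2⟩ := mem_Th.1 hp
      rw [← e1, ← e2, hs w hw]
      exact hw
    · obtain ⟨hz, w, hw, rfl⟩ := mem_Pr.1 hz
      have : w.filter (hi m) = [] := by
        by_contra hc
        exact hu (w.filter (lo m), w.filter (hi m)) (mem_Th.2 ⟨hz, hc, w, hw, rfl, rfl⟩) rfl
      have e := hs w hw
      rw [this, List.append_nil] at e
      rwa [e]
    · obtain ⟨hz, w, hw, rfl⟩ := mem_Pr.1 hz
      have : w.filter (lo m) = [] := by
        by_contra hc
        exact hu (w.filter (lo m), w.filter (hi m)) (mem_Th.2 ⟨hc, hz, w, hw, rfl, rfl⟩) rfl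
      have e := hs w hw
      rw [this, List.nil_append] at e
      rwa [e]
  · intro hz
    have e := hs z hz
    have hz0 : z ≠ [] := fun h => h0 (h ▸ hz)
    by_cases h1 : z.filter (lo m) = []
    · rw [h1, List.nil_append] at e
      right; right
      refine ⟨mem_Pr.2 ⟨hz0, z, hz, e⟩, ?_⟩
      rintro p hp rfl
      obtain ⟨p1, p2, w, hw, e1, e2⟩ := mem_Th.1 hp
      have : w = p.2 := hhi w hw _ hz (e2 ▸ p2) (e.symm ▸ p2) (by rw [e2, e])
      rw [this, h1] at e1
      exact p1 e1.symm
    · by_cases h2 : z.filter (hi m) = []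
      · rw [h2, List.append_nil] at e
        right; left
        refine ⟨mem_Pr.2 ⟨hz0, z, hz, e⟩, ?_⟩
        rintro p hp rfl
        obtain ⟨p1, p2, w, hw, e1, e2⟩ := mem_Th.1 hp
        have : w = p.1 := hlo w hw _ hz (e1 ▸ p1) (e.symm ▸ p1) (by rw [e1, e])
        rw [this, h2] at e2
        exact p2 e2.symm
      · left
        exact ⟨(z.filter (lo m), z.filter (hi m)), mem_Th.2 ⟨h1, h2, z, hz, rfl, rfl⟩, e⟩

theorem glue_empty : glueSet X Y ∅ = X ∪ Y := by
  ext z; simp [mem_glue]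

theorem rtg_glue (h : SepW m X Y) (hm : Mat X Y Θ) :
    Relation.ReflTransGen Step (X ∪ Y) (glueSet X Y Θ) := by
  induction Θ using Finset.induction_on with
  | empty => rw [glue_empty]
  | insert p Θ hp ih =>
    have hm' : Mat X Y Θ := ⟨fun q hq => hm.1 (Finset.mem_insert_of_mem hq),
      fun q hq r hr => hm.2 q (Finset.mem_insert_of_mem hq) r (Finset.mem_insert_of_mem hr)⟩
    refine (ih hm').tail ?_
    have hpp := Finset.mem_product.1 (hm.1 (Finset.mem_insert_self p Θ))
    have hu : ∀ q ∈ Θ, q.1 ≠ p.1 := fun q hq e => hp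
      ((hm.2 q (Finset.mem_insert_of_mem hq) p (Finset.mem_insert_self _ _) (Or.inl e)) ▸ hq)
    have hv : ∀ q ∈ Θ, q.2 ≠ p.2 := fun q hq e => hp
      ((hm.2 q (Finset.mem_insert_of_mem hq) p (Finset.mem_insert_self _ _) (Or.inr e)) ▸ hq)
    have hXY : ∀ u ∈ X, u ∉ Y := fun u h1 h2 => (h.1 u h1).1 ((h.lo_X h1).symm.trans (h.lo_Y h2))
    have hcX : ∀ q ∈ Θ, q.1 ++ q.2 ∉ X := by
      intro q hq hc
      have hqq := Finset.mem_product.1 (hm'.1 hq)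
      have := h.hi_X hc
      rw [List.filter_append, h.hi_Y hqq.2] at this
      exact (h.2 _ hqq.2).1 (List.append_eq_nil_iff.1 this).2
    have hcY : ∀ q ∈ Θ, q.1 ++ q.2 ∉ Y := by
      intro q hq hc
      have hqq := Finset.mem_product.1 (hm'.1 hq)
      have := h.lo_Y hc
      rw [List.filter_append, h.lo_X hqq.1] at this
      exact (h.1 _ hqq.1).1 (List.append_eq_nil_iff.1 this).1
    refine ⟨p.1, mem_glue.2 (Or.inr (Or.inl ⟨hpp.1, hu⟩)), p.2,
      mem_glue.2 (Or.inr (Or.inr ⟨hpp.2, hv⟩)), fun e => hXY p.1 hpp.1 (e ▸ hpp.2), ?_, ?_⟩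
    · intro x hx y hy
      have := (h.1 _ hpp.1).2 x hx
      have := (h.2 _ hpp.2).2 y hy
      omega
    · ext z
      simp only [mem_glue, Finset.mem_insert, Finset.mem_erase]
      constructor
      · rintro (⟨q, rfl | hq, rfl⟩ | ⟨hz, hq⟩ | ⟨hz, hq⟩)
        · exact Or.inl rfl
        · exact Or.inr ⟨fun e => hcY q hq (e ▸ hpp.2), fun e => hcX q hq (e ▸ hpp.1),
            Or.inl ⟨q, hq, rfl⟩⟩
        · exact Or.inr ⟨fun e => hXY z hz (e ▸ hpp.2), fun e => hq p (Or.inl rfl) e.symm,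
            Or.inr (Or.inl ⟨hz, fun q h => hq q (Or.inr h)⟩)⟩
        · exact Or.inr ⟨fun e => hq p (Or.inl rfl) e.symm, fun e => hXY z (e ▸ hpp.1) hz,
            Or.inr (Or.inr ⟨hz, fun q h => hq q (Or.inr h)⟩)⟩
      · rintro (rfl | ⟨h2, h1, ⟨q, hq, rfl⟩ | ⟨hz, hq⟩ | ⟨hz, hq⟩⟩)
        · exact Or.inl ⟨p, Or.inl rfl, rfl⟩
        · exact Or.inl ⟨q, Or.inr hq, rfl⟩
        · refine Or.inr (Or.inl ⟨hz, ?_⟩)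
          rintro q (rfl | h)
          · exact fun e => h1 e.symm
          · exact hq q h
        · refine Or.inr (Or.inr ⟨hz, ?_⟩)
          rintro q (rfl | h)
          · exact fun e => h2 e.symm
          · exact hq q h

theorem inj_lo_union (h : SepW m X Y) (hg : Good X) : Inj (lo m) (X ∪ Y) := by
  intro w hw w' hw' h1 h2 e
  rcases Finset.mem_union.1 hw with hw | hw
  · rcases Finset.mem_union.1 hw' with hw' | hw'
    · rw [h.lo_X hw, h.lo_X hw'] at e
      exact hg.2 w hw w' hw' e
    · exact absurd (h.lo_Y hw') h2
  · exact absurd (h.lo_Y hw) h1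

theorem inj_hi_union (h : SepW m X Y) (hg : Good Y) : Inj (hi m) (X ∪ Y) := by
  intro w hw w' hw' h1 h2 e
  rcases Finset.mem_union.1 hw with hw | hw
  · exact absurd (h.hi_X hw) h1
  · rcases Finset.mem_union.1 hw' with hw' | hw'
    · exact absurd (h.hi_X hw') h2
    · rw [h.hi_Y hw, h.hi_Y hw'] at e
      exact hg.2 w hw w' hw' e

theorem mat_empty : Mat X Y ∅ := by simp [Mat]

theorem unglue (h : SepW m X Y) (hX : Good X) (hY : Good Y) {G : Finset W}
    (hr : Relation.ReflTransGen Step (X ∪ Y) G) :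
    Inj (lo m) G ∧ Inj (hi m) G ∧ Spl m G ∧ [] ∉ G ∧
      Relation.ReflTransGen Step X (Pr (lo m) G) ∧ Relation.ReflTransGen Step Y (Pr (hi m) G) := by
  induction hr with
  | refl =>
    refine ⟨inj_lo_union h hX, inj_hi_union h hY, ?_, ?_, ?_, ?_⟩
    · intro w hw
      rcases Finset.mem_union.1 hw with hw | hw
      · rw [h.lo_X hw, h.hi_X hw, List.append_nil]
      · rw [h.lo_Y hw, h.hi_Y hw, List.nil_append]
    · intro hc
      rcases Finset.mem_union.1 hc with hw | hw
      · exact (h.1 _ hw).1 rfl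
      · exact (h.2 _ hw).1 rfl
    · rw [← glue_empty, Pr_lo_glue h mat_empty]
    · rw [← glue_empty, Pr_hi_glue h mat_empty]
  | tail _ hs ih =>
    obtain ⟨h1, h2, h3, h4, h5, h6⟩ := ih
    exact ⟨inj_step h1 hs, inj_step h2 hs, spl_step h3 hs, nil_step h4 hs,
      h5.trans (pr_step h1 hs), h6.trans (pr_step h2 hs)⟩

end

theorem step_union {G G' H : Finset W} (h : Step G G') (hd : Disjoint G H) :
    Step (G ∪ H) (G' ∪ H) := by
  obtain ⟨u, hu, v, hv, huv, hle, rfl⟩ := h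
  refine ⟨u, by simp [hu], v, by simp [hv], huv, hle, ?_⟩
  have hu' := Finset.disjoint_left.1 hd hu
  have hv' := Finset.disjoint_left.1 hd hv
  ext z
  simp only [Finset.mem_union, Finset.mem_insert, Finset.mem_erase]
  constructor
  · rintro ((h | h) | h)
    · exact Or.inl h
    · exact Or.inr ⟨h.1, h.2.1, Or.inl h.2.2⟩
    · exact Or.inr ⟨fun e => hv' (e ▸ h), fun e => hu' (e ▸ h), Or.inr h⟩
  · tauto

/-- A property of letters common to all words is preserved. -/
theorem letters_step {q : ℕ → Prop} {G G' : Finset W} (h : Step G G')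
    (hq : ∀ w ∈ G, w ≠ [] ∧ ∀ x ∈ w, q x) : ∀ w ∈ G', w ≠ [] ∧ ∀ x ∈ w, q x := by
  obtain ⟨u, hu, v, hv, huv, hle, rfl⟩ := h
  intro w hw
  simp only [Finset.mem_insert, Finset.mem_erase] at hw
  rcases hw with rfl | hw
  · refine ⟨by simp [(hq u hu).1], ?_⟩
    intro x hx
    rcases List.mem_append.1 hx with hx | hx
    · exact (hq u hu).2 x hx
    · exact (hq v hv).2 x hx
  · exact hq w hw.2.2

theorem SepW.disj {m : ℕ} {X Y : Finset W} (h : SepW m X Y) : Disjoint X Y :=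
  Finset.disjoint_left.2 fun u h1 h2 => (h.1 u h1).1 ((h.lo_X h1).symm.trans (h.lo_Y h2))

theorem rtg_union {m : ℕ} {X Y X' Y' : Finset W} (h : SepW m X Y)
    (h1 : Relation.ReflTransGen Step X X') (h2 : Relation.ReflTransGen Step Y Y') :
    SepW m X' Y' ∧ Relation.ReflTransGen Step (X ∪ Y) (X' ∪ Y') := by
  have a1 : SepW m X' Y ∧ Relation.ReflTransGen Step (X ∪ Y) (X' ∪ Y) := by
    induction h1 with
    | refl => exact ⟨h, Relation.ReflTransGen.refl⟩
    | tail _ hs ih =>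
      exact ⟨⟨letters_step hs ih.1.1, h.2⟩, ih.2.tail (step_union hs ih.1.disj)⟩
  induction h2 with
  | refl => exact a1
  | tail _ hs ih =>
    refine ⟨⟨a1.1.1, letters_step hs ih.1.2⟩, ih.2.tail ?_⟩
    rw [Finset.union_comm, Finset.union_comm X']
    exact step_union hs ih.1.disj.symm

theorem shiftW_inj (m : ℕ) : Function.Injective (shiftW m) :=
  List.map_injective_iff.2 (fun x y h => by simpa using h)

theorem shiftW_append (m : ℕ) (u v : W) : shiftW m (u ++ v) = shiftW m u ++ shiftW m v := by
  simp [shiftW]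

theorem image_step (m : ℕ) (G : Finset W) (u v : W) :
    (insert (u ++ v) ((G.erase u).erase v)).image (shiftW m) =
    insert (shiftW m u ++ shiftW m v)
      (((G.image (shiftW m)).erase (shiftW m u)).erase (shiftW m v)) := by
  rw [Finset.image_insert, Finset.image_erase (shiftW_inj m), Finset.image_erase (shiftW_inj m),
    shiftW_append]

theorem step_shift {m : ℕ} {G G' : Finset W} (h : Step G G') :
    Step (G.image (shiftW m)) (G'.image (shiftW m)) := by
  obtain ⟨u, hu, v, hv, huv, hle, rfl⟩ := h
  refine ⟨_, Finset.mem_image_of_mem _ hu, _, Finset.mem_image_of_mem _ hv,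
    fun e => huv (shiftW_inj m e), ?_, image_step m G u v⟩
  intro x hx y hy
  simp only [shiftW, List.mem_map] at hx hy
  obtain ⟨x, hx, rfl⟩ := hx
  obtain ⟨y, hy, rfl⟩ := hy
  have := hle x hx y hy
  omega

theorem step_unshift {m : ℕ} {G H : Finset W} (h : Step (G.image (shiftW m)) H) :
    ∃ G', Step G G' ∧ H = G'.image (shiftW m) := by
  obtain ⟨u', hu, v', hv, huv, hle, rfl⟩ := h
  obtain ⟨u, hu1, rfl⟩ := Finset.mem_image.1 hu
  obtain ⟨v, hv1, rfl⟩ := Finset.mem_image.1 hv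
  refine ⟨_, ⟨u, hu1, v, hv1, fun e => huv (by rw [e]), ?_, rfl⟩, (image_step m G u v).symm⟩
  intro x hx y hy
  have := hle (x + m) (by simpa [shiftW] using hx) (y + m) (by simpa [shiftW] using hy)
  omega

theorem rtg_shift {m : ℕ} {G G' : Finset W} (h : Relation.ReflTransGen Step G G') :
    Relation.ReflTransGen Step (G.image (shiftW m)) (G'.image (shiftW m)) := by
  induction h with
  | refl => exact Relation.ReflTransGen.refl
  | tail _ hs ih => exact ih.tail (step_shift hs)

theorem rtg_unshift {m : ℕ} {G H : Finset W}
    (h : Relation.ReflTransGen Step (G.image (shiftW m)) H) :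
    ∃ G', Relation.ReflTransGen Step G G' ∧ H = G'.image (shiftW m) := by
  induction h with
  | refl => exact ⟨G, Relation.ReflTransGen.refl, rfl⟩
  | tail _ hs ih =>
    obtain ⟨G', h1, rfl⟩ := ih
    obtain ⟨G'', h2, rfl⟩ := step_unshift hs
    exact ⟨G'', h1.tail h2, rfl⟩

theorem LR_perm (a : W) : (LR a).flatten.Perm a := by
  have h1 : (LR a).flatten.Perm (segs a).flatten := (List.reverse_perm (segs a)).flatten
  rwa [segs_flat] at h1

theorem cov_perm {a b : W} (h : CovStar a b) : b.Perm a := by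
  obtain ⟨A, B, C, u, v, e, hle, hb⟩ := (covStar_iff a b).1 h
  refine (LR_perm b).symm.trans (List.Perm.trans ?_ (LR_perm a))
  rw [e, hb]
  rw [List.perm_iff_count]
  intro x
  simp only [List.flatten_append, List.flatten_cons, List.count_append]
  omega

theorem le_perm {a b : W} (h : leStar a b) : b.Perm a := by
  induction h with
  | refl => exact List.Perm.refl _
  | tail _ hs ih => exact (cov_perm hs).trans ih

theorem isPF_perm {a b : W} (h : b.Perm a) (ha : IsPF a) : IsPF b := by
  have e : b.insertionSort (· ≤ ·) = a.insertionSort (· ≤ ·) :=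
    List.Perm.eq_of_pairwise' (List.pairwise_insertionSort _ _) (List.pairwise_insertionSort _ _)
      (((List.perm_insertionSort _ b).trans h).trans (List.perm_insertionSort _ a).symm)
  refine ⟨fun x hx => ha.1 x (h.mem_iff.1 hx), ?_⟩
  rw [e, h.length_eq]
  exact ha.2

theorem pf_le {a : W} (ha : IsPF a) : ∀ x ∈ a, x ≤ a.length := by
  intro x hx
  have hx' : x ∈ a.insertionSort (· ≤ ·) := (List.mem_insertionSort _).2 hx
  obtain ⟨i, hi, rfl⟩ := List.getElem_of_mem hx'
  have hi' : i < a.length := by simpa using hi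
  have := ha.2 i hi'
  rw [List.getD_eq_getElem _ _ hi] at this
  omega

theorem mem_pf {n : ℕ} {b : W} : b ∈ pfFinset n ↔ b.length = n ∧ IsPF b := by
  simp only [pfFinset, Finset.mem_filter, Finset.mem_image, Finset.mem_univ, true_and]
  constructor
  · rintro ⟨⟨f, rfl⟩, h⟩
    exact ⟨by simp, h⟩
  · rintro ⟨rfl, h⟩
    refine ⟨⟨fun i => ⟨b[i] - 1, ?_⟩, ?_⟩, h⟩
    · have h1 := pf_le h b[i] (List.getElem_mem _)
      have h2 := h.1 b[i] (List.getElem_mem _)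
      omega
    · apply List.ext_getElem
      · simp
      · intro i h1 h2
        have h2 := h.1 b[i] (List.getElem_mem _)
        simp
        omega

theorem slash_pf {a b : W} (ha : IsPF a) (hb : IsPF b) : IsPF (slashProd a b) := by
  have e : (slashProd a b).insertionSort (· ≤ ·) =
      a.insertionSort (· ≤ ·) ++ shiftW a.length (b.insertionSort (· ≤ ·)) := by
    apply List.Perm.eq_of_pairwise' (r := (· ≤ ·)) (List.pairwise_insertionSort _ _)
    · rw [List.pairwise_append]
      refine ⟨List.pairwise_insertionSort _ _, ?_, ?_⟩
      · unfold shiftW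
        rw [List.pairwise_map]
        exact (List.pairwise_insertionSort (· ≤ ·) b).imp (fun h => by omega)
      · intro x hx y hy
        have := pf_le ha x ((List.mem_insertionSort _).1 hx)
        simp only [shiftW, List.mem_map] at hy
        omega
    · refine (List.perm_insertionSort _ _).trans ?_
      refine List.perm_append_comm.trans ?_
      exact ((List.perm_insertionSort _ a).symm).append
        (((List.perm_insertionSort _ b).symm).map _)
  constructor
  · intro x hx
    rcases List.mem_append.1 hx with h | h
    · simp only [shiftW, List.mem_map] at h
      obtain ⟨y, hy, rfl⟩ := h
      have := hb.1 y hy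
      omega
    · exact ha.1 x h
  · intro i hi
    rw [e]
    have hl : (slashProd a b).length = b.length + a.length := by simp [slashProd, shiftW]
    by_cases h : i < a.length
    · rw [List.getD_append _ _ _ _ (by simpa using h)]
      exact ha.2 i h
    · rw [List.getD_append_right _ _ _ _ (by simpa using h)]
      have hj : i - a.length < b.length := by omega
      have := hb.2 (i - a.length) hj
      rw [List.getD_eq_getElem _ _ (by simpa using hj)] at this
      rw [List.getD_eq_getElem _ _ (by simpa [shiftW] using hj)]
      simp [shiftW] at this ⊢
      omega

theorem Desc.shift {L : List W} (m : ℕ) (h : Desc L) : Desc (L.map (shiftW m)) := by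
  have hh : ∀ w : W, w ≠ [] → (shiftW m w).headD 0 = w.headD 0 + m := by
    intro w hw
    cases w with
    | nil => simp at hw
    | cons x xs => simp [shiftW]
  constructor
  · intro w hw
    obtain ⟨v, hv, rfl⟩ := List.mem_map.1 hw
    obtain ⟨h1, h2⟩ := h.1 v hv
    refine ⟨by simpa [shiftW] using h1, ?_⟩
    intro x hx
    rw [hh v h1]
    simp only [shiftW, List.mem_map] at hx
    obtain ⟨y, hy, rfl⟩ := hx
    have := h2 y hy
    omega
  · rw [List.pairwise_map]
    refine List.Pairwise.imp_of_mem ?_ h.2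
    intro u v hu hv huv
    rw [hh u (h.1 u hu).1, hh v (h.1 v hv).1]
    omega

theorem shift_flatten (m : ℕ) (L : List W) : (L.map (shiftW m)).flatten = shiftW m L.flatten := by
  unfold shiftW
  rw [List.map_flatten]

theorem mem_FS_letters {a w : W} (h : w ∈ FS a) : w ≠ [] ∧ ∀ x ∈ w, x ∈ a := by
  refine ⟨((FS_good a).1 w h).1, fun x hx => ?_⟩
  have : w ∈ LR a := by simpa [FS] using h
  exact (LR_perm a).mem_iff.1 (List.mem_flatten.2 ⟨w, this, hx⟩)

theorem sep_FS {a b : W} (ha : IsPF a) (hb : IsPF b) :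
    SepW a.length (FS a) ((FS b).image (shiftW a.length)) := by
  constructor
  · intro u hu
    exact ⟨(mem_FS_letters hu).1, fun x hx => pf_le ha x ((mem_FS_letters hu).2 x hx)⟩
  · intro u hu
    obtain ⟨v, hv, rfl⟩ := Finset.mem_image.1 hu
    refine ⟨by simpa [shiftW] using (mem_FS_letters hv).1, ?_⟩
    intro x hx
    simp only [shiftW, List.mem_map] at hx
    obtain ⟨y, hy, rfl⟩ := hx
    have := hb.1 y ((mem_FS_letters hv).2 y hy)
    omega

theorem headD_mem {w : W} (h : w ≠ []) : w.headD 0 ∈ w := by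
  cases w with
  | nil => simp at h
  | cons x xs => simp

theorem good_shift {b : W} (m : ℕ) : Good ((FS b).image (shiftW m)) := by
  have := ((segs_desc b).shift m).good
  have e : ((segs b).map (shiftW m)).toFinset = (FS b).image (shiftW m) := by
    ext; simp [FS, LR]
  rwa [e] at this

theorem FS_slash {a b : W} (ha : IsPF a) (hb : IsPF b) :
    FS (slashProd a b) = FS a ∪ (FS b).image (shiftW a.length) := by
  have hsep := sep_FS ha hb
  have hd : Desc ((segs b).map (shiftW a.length) ++ segs a) := by
    have h1 := (segs_desc b).shift a.length
    have h2 := segs_desc a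
    constructor
    · intro w hw
      rcases List.mem_append.1 hw with h | h
      · exact h1.1 w h
      · exact h2.1 w h
    · rw [List.pairwise_append]
      refine ⟨h1.2, h2.2, ?_⟩
      intro u hu v hv
      have k1 := hsep.1 v (by simpa [FS, LR] using hv)
      have k2 := hsep.2 u (by simpa [FS, LR] using hu)
      have := k1.2 _ (headD_mem k1.1)
      have := k2.2 _ (headD_mem k2.1)
      omega
  have : segs (slashProd a b) = (segs b).map (shiftW a.length) ++ segs a := by
    rw [← segs_flatten _ hd, List.flatten_append, shift_flatten, segs_flat, segs_flat]
    rfl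
  unfold FS LR
  rw [this]
  ext w
  simp

theorem shiftF_FS (m : ℕ) (b : W) : (shiftF m (LR b)).toFinset = (FS b).image (shiftW m) := by
  ext; simp [shiftF, FS]

theorem mem_Rset {a b : W} {Θ : Finset (W × W)} :
    Θ ∈ Rset a b ↔ Mat (FS a) ((FS b).image (shiftW a.length)) Θ := by
  rw [← shiftF_FS]
  simp only [Rset, Finset.mem_filter, Finset.mem_powerset, Mat, FS]

theorem mTheta_eq (a b : W) (Θ : Finset (W × W)) :
    mTheta a b Θ = wordOfSet (glueSet (FS a) ((FS b).image (shiftW a.length)) Θ) := by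
  rw [← shiftF_FS]; rfl

theorem forward {a b a' b' : W} {Θ : Finset (W × W)} (ha : IsPF a) (hb : IsPF b)
    (hla : a'.length = a.length) (haa : leStar a a') (hbb : leStar b b')
    (hΘ : Θ ∈ Rset a' b') :
    leStar (slashProd a b) (mTheta a' b' Θ) ∧
      FS (mTheta a' b' Θ) = glueSet (FS a') ((FS b').image (shiftW a.length)) Θ := by
  rw [mem_Rset, hla] at hΘ
  rw [mTheta_eq, hla]
  obtain ⟨h1, h2⟩ := rtg_union (sep_FS ha hb) (rtg_of_le haa) (rtg_shift (rtg_of_le hbb))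
  have h3 := h2.trans (rtg_glue h1 hΘ)
  rw [← FS_slash ha hb] at h3
  obtain ⟨h4, h5⟩ := le_of_rtg h3
  exact ⟨h5, FS_wordOfSet h4⟩

theorem backward {a b c : W} (ha : IsPF a) (hb : IsPF b) (h : leStar (slashProd a b) c) :
    ∃ a' b' Θ, leStar a a' ∧ leStar b b' ∧ Θ ∈ Rset a' b' ∧ mTheta a' b' Θ = c := by
  have hr := rtg_of_le h
  rw [FS_slash ha hb] at hr
  obtain ⟨h1, h2, h3, h4, h5, h6⟩ :=
    unglue (sep_FS ha hb) (FS_good a) (good_shift a.length) hr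
  obtain ⟨Y, hY, eY⟩ := rtg_unshift h6
  obtain ⟨gX, lX⟩ := le_of_rtg h5
  obtain ⟨gY, lY⟩ := le_of_rtg hY
  have hl := (le_perm lX).length_eq
  refine ⟨_, _, Th a.length (FS c), lX, lY, ?_, ?_⟩
  · rw [mem_Rset, hl, FS_wordOfSet gX, FS_wordOfSet gY, ← eY]
    exact mat_Th h1 h2
  · rw [mTheta_eq, hl, FS_wordOfSet gX, FS_wordOfSet gY, ← eY, glue_Th h1 h2 h3 h4, wordOfSet_FS]

theorem starF_single (K : Type) [Field K] (s t : Finset W) :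
    starF K (∑ a ∈ s, Mb K a) (∑ b ∈ t, Mb K b) = ∑ a ∈ s, ∑ b ∈ t, mulSingle K a b := by
  unfold starF
  rw [← Finsupp.sum_finsetSum_index]
  · refine Finset.sum_congr rfl fun a _ => ?_
    unfold Mb
    rw [Finsupp.sum_single_index]
    · rw [← Finsupp.sum_finsetSum_index]
      · refine Finset.sum_congr rfl fun b _ => ?_
        rw [Finsupp.sum_single_index] <;> simp
      · simp
      · intro b x y; rw [mul_add, add_smul]
    · simp
  · intro a; simp
  · intro a x y
    rw [← Finsupp.sum_add]
    refine Finset.sum_congr rfl fun b _ => ?_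
    simp only [add_mul, add_smul]

/-- For all parking functions `a`, `b`: `Q_a ⋆ Q_b = Q_{a|b}`. -/
theorem stmt12 (K : Type) [Field K] [CharZero K] (a b : W)
    (ha : IsPF a) (hb : IsPF b) :
    starF K (Qb K a) (Qb K b) = Qb K (slashProd a b) := by
  unfold Qb
  rw [starF_single]
  unfold mulSingle
  rw [Finset.sum_congr rfl (fun a' _ => Finset.sum_sigma' _ _ _), Finset.sum_sigma']
  refine Finset.sum_bij (fun x _ => mTheta x.1 x.2.1 x.2.2) ?_ ?_ ?_ (fun _ _ => rfl)
  · rintro ⟨a', b', Θ⟩ hx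
    simp only [Finset.mem_sigma, Finset.mem_filter, mem_pf] at hx ⊢
    obtain ⟨⟨⟨h1, h2⟩, h3⟩, ⟨⟨h4, h5⟩, h6⟩, h7⟩ := hx
    obtain ⟨k1, k2⟩ := forward ha hb h1 h3 h6 h7
    exact ⟨⟨(le_perm k1).length_eq, isPF_perm (le_perm k1) (slash_pf ha hb)⟩, k1⟩
  · rintro ⟨a', b', Θ⟩ hx ⟨a'', b'', Θ'⟩ hy e
    simp only [Finset.mem_sigma, Finset.mem_filter, mem_pf] at hx hy e
    obtain ⟨⟨⟨h1, h2⟩, h3⟩, ⟨⟨h4, h5⟩, h6⟩, h7⟩ := hx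
    obtain ⟨⟨⟨i1, i2⟩, i3⟩, ⟨⟨i4, i5⟩, i6⟩, i7⟩ := hy
    have k := (forward ha hb h1 h3 h6 h7).2
    have l := (forward ha hb i1 i3 i6 i7).2
    rw [e, l] at k
    have s1 := sep_FS h2 h5
    have s2 := sep_FS i2 i5
    rw [mem_Rset] at h7 i7
    rw [h1] at s1 h7
    rw [i1] at s2 i7
    have eX := (Pr_lo_glue s2 i7).symm.trans ((congrArg _ k).trans (Pr_lo_glue s1 h7))
    have eY := (Pr_hi_glue s2 i7).symm.trans ((congrArg _ k).trans (Pr_hi_glue s1 h7))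
    have eT := (Th_glue s2 i7).symm.trans ((congrArg _ k).trans (Th_glue s1 h7))
    have eY' := Finset.image_injective (shiftW_inj _) eY
    have ea : a'' = a' := by rw [← wordOfSet_FS a'', eX, wordOfSet_FS]
    have eb : b'' = b' := by rw [← wordOfSet_FS b'', eY', wordOfSet_FS]
    subst ea eb eT
    rfl
  · intro c hc
    simp only [Finset.mem_filter, mem_pf] at hc
    obtain ⟨a', b', Θ, h1, h2, h3, h4⟩ := backward ha hb hc.2
    refine ⟨⟨a', b', Θ⟩, ?_, h4⟩
    simp only [Finset.mem_sigma, Finset.mem_filter, mem_pf]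
    exact ⟨⟨⟨(le_perm h1).length_eq, isPF_perm (le_perm h1) ha⟩, h1⟩,
      ⟨⟨(le_perm h2).length_eq, isPF_perm (le_perm h2) hb⟩, h2⟩, h3⟩
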